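/- Let π_ν be the multivariate student's t density on ℝ^d with ν > 0 degrees of freedom. Then for every x ∈ ℝ^d, Σ_{i=1}^d (∂ log π_ν(x)/∂x_i) · x_i = −((ν+d)/ν) · ‖x‖²/(1 + ‖x‖²/ν), and this quantity converges to −(ν+d) as ‖x‖ → ∞. Consequently, limsup_{‖x‖→∞} Σ_{i=1}^d (∂ log π_ν(x)/∂x_i) x_i + 2d = d − ν, which is strictly less than 1/2 if and only if ν > d − 1/2 (the condition under which the Stereographic Bouncy Particle Sampler is uniformly ergodic). -/

import Mathlib

open Filter

/-- Multivariate student's t density with `ν` degrees of freedom on `ℝ^d`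
(with normalizing constant `c`): `π_ν(x) = c (1 + ‖x‖²/ν)^{−(ν+d)/2}`. -/
noncomputable def tDensity (d : ℕ) (ν c : ℝ) (x : EuclideanSpace ℝ (Fin d)) : ℝ :=
  c * (1 + ‖x‖ ^ 2 / ν) ^ (-(ν + d) / 2 : ℝ)

theorem log_tDensity (d : ℕ) {ν c : ℝ} (hν : 0 < ν) (hc : 0 < c)
    (x : EuclideanSpace ℝ (Fin d)) :
    Real.log (tDensity d ν c x) =
      Real.log c + -(ν + d) / 2 * Real.log (1 + ‖x‖ ^ 2 / ν) := by
  have h : 0 < 1 + ‖x‖ ^ 2 / ν := by positivity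
  rw [tDensity, Real.log_mul hc.ne' (Real.rpow_pos_of_pos h _).ne', Real.log_rpow h]

theorem hasFDerivAt_log_tDensity (d : ℕ) {ν c : ℝ} (hν : 0 < ν) (hc : 0 < c)
    (x : EuclideanSpace ℝ (Fin d)) :
    HasFDerivAt (fun y => Real.log (tDensity d ν c y))
      ((-((ν + d) / ν) / (1 + ‖x‖ ^ 2 / ν)) • innerSL ℝ x) x := by
  have h : 0 < 1 + ‖x‖ ^ 2 / ν := by positivity
  simp only [log_tDensity d hν hc]
  have h1 := (hasStrictFDerivAt_norm_sq x).hasFDerivAt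
  have h2 := (((((h1.mul_const ν⁻¹).const_add 1).log
    (by simpa [div_eq_mul_inv] using h.ne')).const_mul (-(ν + d) / 2)).const_add (Real.log c))
  simp only [← div_eq_mul_inv] at h2
  refine h2.congr_fderiv ?_
  ext v
  simp
  field_simp
  ring

theorem sum_fderiv_log_tDensity_mul (d : ℕ) {ν c : ℝ} (hν : 0 < ν) (hc : 0 < c)
    (x : EuclideanSpace ℝ (Fin d)) :
    ∑ i, fderiv ℝ (fun y => Real.log (tDensity d ν c y)) x
        (EuclideanSpace.single i 1) * x i =
      -((ν + d) / ν) * (‖x‖ ^ 2 / (1 + ‖x‖ ^ 2 / ν)) := by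
  rw [(hasFDerivAt_log_tDensity d hν hc x).fderiv]
  simp only [smul_apply, innerSL_apply_apply, smul_eq_mul,
    EuclideanSpace.inner_single_right, conj_trivial, one_mul, mul_assoc]
  rw [← Finset.mul_sum, EuclideanSpace.real_norm_sq_eq]
  simp only [← sq]
  ring

theorem tendsto_sq_div_one_add_sq_div {ν : ℝ} (hν : 0 < ν) :
    Tendsto (fun r : ℝ => r ^ 2 / (1 + r ^ 2 / ν)) atTop (nhds ν) := by
  have h1 : Tendsto (fun r : ℝ => 1 + r ^ 2 / ν) atTop atTop :=
    tendsto_atTop_add_const_left _ _ ((tendsto_pow_atTop two_ne_zero).atTop_div_const hν)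
  have h2 := (h1.inv_tendsto_atTop.const_sub 1).const_mul ν
  simp only [sub_zero, mul_one] at h2
  refine h2.congr fun r => ?_
  have h : 0 < 1 + r ^ 2 / ν := by positivity
  have h' : 0 < ν + r ^ 2 := by positivity
  simp only [Pi.inv_apply]
  field_simp
  ring

/-- For the multivariate student's t density with `ν` degrees of freedom:
`∑_i (∂ log π_ν/∂x_i)(x) · x_i = −((ν+d)/ν) ‖x‖²/(1 + ‖x‖²/ν)`; this quantity
tends to `−(ν+d)` as `‖x‖ → ∞`; consequently its `limsup` as `‖x‖ → ∞` plus `2d`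
equals `d − ν`, which is `< 1/2` iff `ν > d − 1/2`. -/
theorem stmt_12 (d : ℕ) (hd : 1 ≤ d) (ν c : ℝ) (hν : 0 < ν) (hc : 0 < c) :
    (∀ x : EuclideanSpace ℝ (Fin d),
      ∑ i, fderiv ℝ (fun y => Real.log (tDensity d ν c y)) x
          (EuclideanSpace.single i 1) * x i =
        -((ν + d) / ν) * (‖x‖ ^ 2 / (1 + ‖x‖ ^ 2 / ν))) ∧
    Tendsto (fun x : EuclideanSpace ℝ (Fin d) =>
        ∑ i, fderiv ℝ (fun y => Real.log (tDensity d ν c y)) x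
            (EuclideanSpace.single i 1) * x i)
      (comap norm atTop) (nhds (-(ν + d))) ∧
    limsup (fun x : EuclideanSpace ℝ (Fin d) =>
        ∑ i, fderiv ℝ (fun y => Real.log (tDensity d ν c y)) x
            (EuclideanSpace.single i 1) * x i)
      (comap norm atTop) + 2 * d = d - ν ∧
    ((d : ℝ) - ν < 1 / 2 ↔ ν > d - 1 / 2) := by
  have key := sum_fderiv_log_tDensity_mul d hν hc
  have lim : Tendsto (fun x : EuclideanSpace ℝ (Fin d) =>
        ∑ i, fderiv ℝ (fun y => Real.log (tDensity d ν c y)) x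
            (EuclideanSpace.single i 1) * x i)
      (comap norm atTop) (nhds (-(ν + d))) := by
    simp only [key]
    have h := ((tendsto_sq_div_one_add_sq_div hν).comp
      (tendsto_comap (f := (norm : EuclideanSpace ℝ (Fin d) → ℝ)))).const_mul (-((ν + d) / ν))
    rwa [neg_mul, div_mul_cancel₀ _ hν.ne'] at h
  have : Nonempty (Fin d) := ⟨⟨0, hd⟩⟩
  have : NeBot (comap (norm : EuclideanSpace ℝ (Fin d) → ℝ) atTop) := by
    rw [comap_norm_atTop]
    infer_instance
  refine ⟨key, lim, ?_, ?_⟩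
  · rw [lim.limsup_eq]
    ring
  · constructor <;> intro h <;> linarith
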